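/- Let G be a finite group acting on an affine scheme S = Spec A over a field, and let π : S → S/G = Spec A^G be the quotient. For every line bundle L on the quotient stack [S/G] (equivalently, a G-equivariant line bundle on S), there exists d > 0 and a line bundle M on S/G with π*M ≅ L^{⊗d} as G-equivariant line bundles, where S/G carries the trivial G-action. -/

import Mathlib

/-!
STATEMENT 9: Let `G` be a finite group acting on an affine scheme `S = Spec A` over a
field, with quotient `π : S → S/G = Spec Aᴳ`.  For every `G`-equivariant line bundle
`L` on `S` (an invertible `A`-module with a compatible semilinear `G`-action) there
are `d > 0` and an invertible `Aᴳ`-module `M` with `π*M = A ⊗_{Aᴳ} M ≅ L^{⊗d}` as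
`G`-equivariant line bundles, where `Aᴳ` carries the trivial `G`-action.

Invertible modules are encoded as finite projective modules of constant local rank 1;
the `G`-equivariant structure on `L^{⊗d} = ⨂[A]ᵈ L` is encoded by the (unique) family
`ψ` of additive automorphisms agreeing with `σ` on pure tensors, and the `G`-action on
`π*M = A ⊗_{Aᴳ} M` is `g • (a ⊗ m) = (g • a) ⊗ m`.
-/

open scoped TensorProduct PiTensorProduct

/-- An invertible module: finite, projective, of local rank one at every prime. -/
def IsInvertibleModule (R M : Type) [CommRing R] [AddCommGroup M] [Module R M] : Prop :=
  Module.Finite R M ∧ Module.Projective R M ∧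
    ∀ (P : Ideal R) [P.IsPrime],
      Module.finrank (Localization P.primeCompl) (LocalizedModule P.primeCompl M) = 1

/-- The invariant subring `Aᴳ` of a ring with an action of a group `G` by ring
automorphisms. -/
def fixedSubring (G A : Type) [Group G] [CommRing A] [MulSemiringAction G A] :
    Subring A where
  carrier := {a | ∀ g : G, g • a = a}
  zero_mem' := fun g => smul_zero g
  one_mem' := fun g => smul_one g
  add_mem' := fun {a b} ha hb g => by rw [smul_add, ha g, hb g]
  mul_mem' := fun {a b} ha hb g => by rw [smul_mul', ha g, hb g]
  neg_mem' := fun {a} ha g => by rw [smul_neg, ha g]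

/-- A module with a "rank-one dual basis" is invertible. -/
theorem isInvertibleModule_of_dualBasis {R M ι : Type} [CommRing R] [AddCommGroup M] [Module R M]
    [Fintype ι] (m : ι → M) (f : ι → M →ₗ[R] R) (h1 : ∑ i, f i (m i) = 1)
    (hf : ∀ i x y, f i x • y = f i y • x) : IsInvertibleModule R M := by
  have hx : ∀ x, ∑ i, f i x • m i = x := fun x => by
    simp_rw [hf _ x]
    rw [← Finset.sum_smul, h1, one_smul]
  have hg : ∀ (g : M →ₗ[R] R) x y, g x • y = g y • x := fun g x y => by
    have h2 : ∀ z, g z = ∑ i, g (m i) * f i z := fun z => by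
      conv_lhs => rw [← hx z]
      simp [mul_comm]
    rw [h2 x, h2 y, Finset.sum_smul, Finset.sum_smul]
    refine Finset.sum_congr rfl fun i _ => ?_
    rw [mul_smul, mul_smul, hf]
  have hinv : Module.Invertible R M := by
    constructor
    rw [Function.bijective_iff_has_inverse]
    refine ⟨fun r => r • ∑ i, f i ⊗ₜ[R] m i, fun t => ?_, fun r => ?_⟩
    · dsimp only
      induction t with
      | zero => simp
      | add a b ha hb => rw [map_add, add_smul, ha, hb]
      | tmul g x =>
        rw [contractLeft_apply, Finset.smul_sum]
        have : ∀ i, g x • (f i ⊗ₜ[R] m i : Module.Dual R M ⊗[R] M) = (g (m i) • f i) ⊗ₜ[R] x :=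
          fun i => by rw [← TensorProduct.tmul_smul, hg, TensorProduct.tmul_smul,
            ← TensorProduct.smul_tmul']
        simp_rw [this]
        rw [← TensorProduct.sum_tmul]
        congr 1
        ext y
        conv_rhs => rw [← hx y]
        simp [mul_comm]
    · simp only [map_smul, map_sum, contractLeft_apply]
      simp [h1]
  refine ⟨inferInstance, inferInstance, fun P _ => ?_⟩
  exact Module.Invertible.finrank_eq_one _ _

/-- Descent of a rank-one module with enough invariant sections and invariant functionals. -/
theorem descent_aux {G A T ι : Type} [Group G] [CommRing A] [MulSemiringAction G A]
    [AddCommGroup T] [Module A T] [Fintype ι] (ψ : G → (T ≃+ T))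
    (hψ : ∀ (g : G) (a : A) (x : T), ψ g (a • x) = (g • a) • ψ g x)
    (m : ι → T) (F : ι → T →ₗ[A] A)
    (hm : ∀ i g, ψ g (m i) = m i) (hF : ∀ i g x, F i (ψ g x) = g • F i x)
    (h1 : ∑ i, F i (m i) = 1) (hr : ∀ i x y, F i x • y = F i y • x) :
    ∃ (M : Type) (_ : AddCommGroup M) (_ : Module (fixedSubring G A) M),
      IsInvertibleModule (fixedSubring G A) M ∧
        ∃ φ : (A ⊗[fixedSubring G A] M) ≃ₗ[A] T,
          ∀ (g : G) (a : A) (m : M),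
            φ ((g • a) ⊗ₜ[fixedSubring G A] m) = ψ g (φ (a ⊗ₜ[fixedSubring G A] m)) := by
  let M : Submodule (fixedSubring G A) T :=
    { carrier := {x | ∀ g, ψ g x = x}
      zero_mem' := fun g => map_zero _
      add_mem' := fun {a b} ha hb g => by rw [map_add, ha g, hb g]
      smul_mem' := fun r x hx g => by
        change ψ g ((r : A) • x) = (r : A) • x
        rw [hψ, hx g, r.2 g] }
  let m' : ι → M := fun i => ⟨m i, hm i⟩
  let f' : ι → M →ₗ[fixedSubring G A] (fixedSubring G A) := fun i =>
    { toFun := fun x => ⟨F i x.1, fun g => by rw [← hF, x.2 g]⟩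
      map_add' := fun x y => Subtype.ext (map_add (F i) _ _)
      map_smul' := fun r x => Subtype.ext (map_smul (F i) (r : A) x.1) }
  have hx : ∀ x, ∑ i, F i x • m i = x := fun x => by
    simp_rw [hr _ x]
    rw [← Finset.sum_smul, h1, one_smul]
  have h1' : ∑ i, f' i (m' i) = 1 := by
    apply Subtype.ext
    rw [AddSubmonoidClass.coe_finsetSum]
    exact h1
  have hr' : ∀ i x y, f' i x • y = f' i y • x := fun i x y => Subtype.ext (hr i x.1 y.1)
  have hx' : ∀ x, ∑ i, f' i x • m' i = x := fun x => by
    simp_rw [hr' _ x]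
    rw [← Finset.sum_smul, h1', one_smul]
  refine ⟨M, inferInstance, inferInstance, isInvertibleModule_of_dualBasis m' f' h1' hr', ?_⟩
  let φ : (A ⊗[fixedSubring G A] M) →ₗ[A] T :=
    TensorProduct.AlgebraTensorModule.lift
      ((LinearMap.lsmul A (M →ₗ[fixedSubring G A] T)).flip M.subtype)
  have hφ : ∀ a (x : M), φ (a ⊗ₜ[fixedSubring G A] x) = a • (x : T) := fun a x => rfl
  let χ : T →ₗ[A] (A ⊗[fixedSubring G A] M) :=
    ∑ i, (LinearMap.toSpanSingleton A _ ((1 : A) ⊗ₜ[fixedSubring G A] m' i)).comp (F i)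
  have hχ : ∀ x, χ x = ∑ i, F i x ⊗ₜ[fixedSubring G A] m' i := fun x => by
    simp [χ, TensorProduct.smul_tmul']
  refine ⟨LinearEquiv.ofLinearMap φ χ ?_ ?_, ?_⟩
  · ext x
    simp only [LinearMap.comp_apply, hχ, map_sum, hφ, LinearMap.id_apply]
    exact hx x
  · ext x
    simp only [TensorProduct.AlgebraTensorModule.curry_apply, LinearMap.restrictScalars_comp,
      TensorProduct.curry_apply, LinearMap.comp_apply, LinearMap.restrictScalars_apply, hφ, hχ,
      one_smul, LinearMap.id_apply]
    have : ∀ i, F i x.1 ⊗ₜ[fixedSubring G A] m' i = (1 : A) ⊗ₜ[fixedSubring G A] (f' i x • m' i) :=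
      fun i => by
        rw [← TensorProduct.smul_tmul]
        congr 1
        exact (mul_one (F i x.1)).symm
    simp_rw [this]
    rw [← TensorProduct.tmul_sum, hx']
  · intro g a x
    rw [LinearEquiv.coe_ofLinearMap, hφ, hφ, hψ, x.2 g]

/-- In an invertible module, `f x • y = f y • x`. -/
theorem IsInvertibleModule.comm_eval {A L : Type} [CommRing A] [AddCommGroup L] [Module A L]
    (hL : IsInvertibleModule A L) (f : L →ₗ[A] A) (x y : L) : f x • y = f y • x := by
  obtain ⟨_, _, h⟩ := hL
  refine Module.eq_of_localization_maximal (R := A) (fun (P : Ideal A) _ => LocalizedModule P.primeCompl L)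
    (fun (P : Ideal A) _ => LocalizedModule.mkLinearMap P.primeCompl L) _ _ fun P hP => ?_
  have h1 := h P
  let fP := IsLocalizedModule.map P.primeCompl (LocalizedModule.mkLinearMap P.primeCompl L)
    (Algebra.linearMap A (Localization P.primeCompl)) f
  have hfP : ∀ z, fP (LocalizedModule.mkLinearMap P.primeCompl L z)
      = algebraMap A (Localization P.primeCompl) (f z) := fun z =>
    IsLocalizedModule.map_apply ..
  let fP' : LocalizedModule P.primeCompl L →ₗ[Localization P.primeCompl]
    Localization P.primeCompl := fP.extendScalarsOfIsLocalization P.primeCompl _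
  have hfP' : ∀ z, fP' (LocalizedModule.mkLinearMap P.primeCompl L z)
      = algebraMap A (Localization P.primeCompl) (f z) := hfP
  have : Module.Free (Localization P.primeCompl) (LocalizedModule P.primeCompl L) :=
    Module.free_of_flat_of_isLocalRing
  obtain ⟨v, hv⟩ : ∃ v, ∀ w : LocalizedModule P.primeCompl L,
      ∃ c : Localization P.primeCompl, c • v = w := by
    let b := Module.basisUnique (R := Localization P.primeCompl) Unit h1
    refine ⟨b default, fun w => ⟨b.repr w default, ?_⟩⟩
    conv_rhs => rw [← b.sum_repr w]
    simp
  obtain ⟨c, hc⟩ := hv (LocalizedModule.mkLinearMap P.primeCompl L x)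
  obtain ⟨d, hd⟩ := hv (LocalizedModule.mkLinearMap P.primeCompl L y)
  rw [map_smul, map_smul, ← algebraMap_smul (Localization P.primeCompl) (f x),
    ← algebraMap_smul (Localization P.primeCompl) (f y), ← hfP', ← hfP', ← hc, ← hd]
  simp only [map_smul, smul_smul, smul_eq_mul]
  congr 1
  ring

/-- In an invertible module, the values of functionals are not contained in a maximal ideal. -/
theorem IsInvertibleModule.exists_eval_notMem {A L : Type} [CommRing A] [AddCommGroup L]
    [Module A L] (hL : IsInvertibleModule A L) (P : Ideal A) [P.IsMaximal] :
    ∃ (f : L →ₗ[A] A) (x : L), f x ∉ P := by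
  obtain ⟨_, _, h⟩ := hL
  by_contra! hc
  have hle : (⊤ : Submodule A L) ≤ P • ⊤ := fun x _ => by
    obtain ⟨s, hs⟩ := (Module.projective_def' (R := A) (P := L)).mp inferInstance
    have := DFunLike.congr_fun hs x
    simp only [LinearMap.comp_apply, LinearMap.id_apply, Finsupp.linearCombination_apply] at this
    rw [← this]
    refine Submodule.sum_mem _ fun y _ => Submodule.smul_mem_smul ?_ trivial
    exact hc ((Finsupp.lapply y).comp s) x
  obtain ⟨r, hr, hr0⟩ := Submodule.exists_sub_one_mem_and_smul_eq_zero_of_fg_of_le_smul P ⊤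
    (Module.Finite.fg_top) hle
  have hrP : r ∉ P := fun h' => (Ideal.ne_top_iff_one P).mp (Ideal.IsPrime.ne_top inferInstance)
    (by simpa using P.sub_mem h' hr)
  have h1 := h P
  have : Subsingleton (LocalizedModule P.primeCompl L) := by
    rw [LocalizedModule.subsingleton_iff]
    exact fun m => ⟨r, hrP, hr0 m trivial⟩
  rw [Module.finrank_zero_of_subsingleton] at h1
  exact zero_ne_one h1

/-- Pure tensors in a power of an invertible module are symmetric. -/
theorem IsInvertibleModule.tprod_perm {A L : Type} [CommRing A] [AddCommGroup L]
    [Module A L] (hL : IsInvertibleModule A L) {d : ℕ} (v : Fin d → L) (π : Equiv.Perm (Fin d)) :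
    PiTensorProduct.tprod A (fun i => v (π i)) = PiTensorProduct.tprod A v := by
  have key : ∀ (w : Fin d → L) (f : L →ₗ[A] A) (x : L),
      (f x) ^ d • PiTensorProduct.tprod A w =
        (∏ i, f (w i)) • PiTensorProduct.tprod A (fun _ : Fin d => x) := fun w f x => by
    have h1 := (PiTensorProduct.tprod A).map_smul_univ (fun _ : Fin d => f x) w
    have h2 := (PiTensorProduct.tprod A).map_smul_univ (fun i : Fin d => f (w i)) (fun _ => x)
    rw [Finset.prod_const, Finset.card_univ, Fintype.card_fin] at h1
    rw [← h1, ← h2]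
    congr 1
    funext i
    exact hL.comm_eval f x (w i)
  rw [← sub_eq_zero]
  set z := PiTensorProduct.tprod A (fun i => v (π i)) - PiTensorProduct.tprod A v with hz
  have htop : Ideal.torsionOf A _ z = ⊤ := by
    by_contra hne
    obtain ⟨P, hP, hle⟩ := Ideal.exists_le_maximal _ hne
    obtain ⟨f, x, hfx⟩ := hL.exists_eval_notMem P
    refine hfx (hP.isPrime.mem_of_pow_mem d (hle ?_))
    rw [Ideal.mem_torsionOf_iff, hz, smul_sub, key, key, sub_eq_zero]
    congr 1
    exact Equiv.prod_comp π fun i => f (v i)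
  have := (Ideal.mem_torsionOf_iff (R := A) z 1).mp (htop ▸ trivial)
  simpa using this

/-- The semilinear additive map induced on a tensor power. -/
noncomputable def psiHom {G A L : Type} [Group G] [CommRing A] [MulSemiringAction G A]
    [AddCommGroup L] [Module A L] (σ : G → (L ≃+ L))
    (hσlin : ∀ (g : G) (a : A) (x : L), σ g (a • x) = (g • a) • σ g x) (d : ℕ) (g : G) :
    (⨂[A] (_ : Fin d), L) →+ (⨂[A] (_ : Fin d), L) :=
  PiTensorProduct.liftAddHom
    (fun p => (g • p.1) • PiTensorProduct.tprod A fun i => σ g (p.2 i))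
    (fun r f i hf => by
      dsimp only
      rw [(PiTensorProduct.tprod A).map_coord_zero i (by rw [hf, map_zero]), smul_zero])
    (fun f => by simp)
    (fun r f i m₁ m₂ => by
      dsimp only
      have h : ∀ m, (fun j => σ g (Function.update f i m j)) =
          Function.update (fun j => σ g (f j)) i (σ g m) := fun m => by
        funext j; by_cases hj : j = i
        · subst hj; simp
        · simp [hj]
      rw [h, h, h, map_add, MultilinearMap.map_update_add, smul_add])
    (fun r r' f => by dsimp only; rw [smul_add, add_smul])
    (fun r f i r' => by
      dsimp only
      have h : ∀ m, (fun j => σ g (Function.update f i m j)) =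
          Function.update (fun j => σ g (f j)) i (σ g m) := fun m => by
        funext j; by_cases hj : j = i
        · subst hj; simp
        · simp [hj]
      rw [h, hσlin, MultilinearMap.map_update_smul, Function.update_eq_self, smul_smul, smul_mul',
        mul_comm])

theorem psiHom_smul_tprod {G A L : Type} [Group G] [CommRing A] [MulSemiringAction G A]
    [AddCommGroup L] [Module A L] (σ : G → (L ≃+ L))
    (hσlin : ∀ (g : G) (a : A) (x : L), σ g (a • x) = (g • a) • σ g x) (d : ℕ) (g : G)
    (r : A) (v : Fin d → L) :
    psiHom σ hσlin d g (r • PiTensorProduct.tprod A v) =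
      (g • r) • PiTensorProduct.tprod A fun i => σ g (v i) := by
  rw [← PiTensorProduct.tprodCoeff_eq_smul_tprod]
  simp only [psiHom, PiTensorProduct.liftAddHom, PiTensorProduct.tprodCoeff, AddCon.coe_mk']
  conv_lhs => apply AddCon.lift_coe
  simp

theorem exists_psi {G A L : Type} [Group G] [CommRing A] [MulSemiringAction G A]
    [AddCommGroup L] [Module A L] (σ : G → (L ≃+ L))
    (hσone : ∀ x : L, σ 1 x = x)
    (hσmul : ∀ (g h : G) (x : L), σ (g * h) x = σ g (σ h x))
    (hσlin : ∀ (g : G) (a : A) (x : L), σ g (a • x) = (g • a) • σ g x) (d : ℕ) :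
    ∃ ψ : G → ((⨂[A] (_ : Fin d), L) ≃+ (⨂[A] (_ : Fin d), L)),
      (∀ (g : G) (v : Fin d → L),
          ψ g (PiTensorProduct.tprod A v) = PiTensorProduct.tprod A fun i => σ g (v i)) ∧
      (∀ (g : G) (a : A) x, ψ g (a • x) = (g • a) • ψ g x) := by
  have hinv : ∀ g h : G, g * h = 1 → ∀ x, psiHom σ hσlin d g (psiHom σ hσlin d h x) = x := by
    intro g h hgh x
    induction x using PiTensorProduct.induction_on with
    | smul_tprod r v =>
      rw [psiHom_smul_tprod, psiHom_smul_tprod, smul_smul, hgh, one_smul]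
      simp only [← hσmul, hgh, hσone]
    | add x y hx hy => rw [map_add, map_add, hx, hy]
  refine ⟨fun g => { psiHom σ hσlin d g with
    invFun := psiHom σ hσlin d g⁻¹
    left_inv := hinv _ _ (inv_mul_cancel g)
    right_inv := hinv _ _ (mul_inv_cancel g) }, fun g v => ?_, fun g a x => ?_⟩
  · change psiHom σ hσlin d g (PiTensorProduct.tprod A v) = _
    have := psiHom_smul_tprod σ hσlin d g 1 v
    rwa [one_smul, smul_one, one_smul] at this
  · change psiHom σ hσlin d g (a • x) = (g • a) • psiHom σ hσlin d g x
    induction x using PiTensorProduct.induction_on with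
    | smul_tprod r v =>
      rw [smul_smul, psiHom_smul_tprod, psiHom_smul_tprod, smul_smul, smul_mul']
    | add x y hx hy => rw [smul_add, map_add, map_add, hx, hy, smul_add]

/-- Simultaneous avoidance of all conjugates of a maximal ideal. -/
theorem IsInvertibleModule.exists_forall_smul_notMem {G A L : Type} [Group G] [Finite G]
    [CommRing A] [MulSemiringAction G A] [AddCommGroup L]
    [Module A L] (hL : IsInvertibleModule A L) (Q : Ideal A) [Q.IsMaximal] :
    ∃ (f : L →ₗ[A] A) (x : L), ∀ g : G, g • f x ∉ Q := by
  classical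
  let q : G → Ideal A := fun g => Q.comap (MulSemiringAction.toRingHom G A g)
  have hq : ∀ g, (q g).IsMaximal := fun g =>
    Ideal.comap_isMaximal_of_surjective _ (MulAction.surjective g)
  let ι := Set.range q
  have hmax : ∀ i : ι, (i : Ideal A).IsMaximal := fun ⟨_, g, hg⟩ => hg ▸ hq g
  have : Fintype ι := Fintype.ofFinite _
  have hcop : Pairwise (Function.onFun IsCoprime fun i : ι => (i : Ideal A)) := fun i j hij =>
    Ideal.isCoprime_iff_sup_eq.mpr
      ((hmax i).coprime_of_ne (hmax j) fun h => hij (Subtype.ext h))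
  have hb : ∀ j : ι, ∃ b : A, ∀ i : ι, b - (Pi.single j 1 : ι → A) i ∈ (i : Ideal A) := fun j =>
    Ideal.exists_forall_sub_mem_ideal hcop _
  choose b hb using hb
  have hfe : ∀ j : ι, ∃ (f : L →ₗ[A] A) (x : L), f x ∉ (j : Ideal A) := fun j =>
    have := hmax j
    hL.exists_eval_notMem _
  choose f e hfe using hfe
  refine ⟨∑ j, b j • f j, ∑ j, b j • e j, fun g hg => ?_⟩
  let i : ι := ⟨q g, g, rfl⟩
  apply hfe i
  have hmem : (∑ j, b j • f j) (∑ j, b j • e j) ∈ (i : Ideal A) := hg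
  rw [← Ideal.Quotient.eq_zero_iff_mem] at hmem ⊢
  have hbi : ∀ j, Ideal.Quotient.mk (i : Ideal A) (b j) = if j = i then 1 else 0 := fun j => by
    rw [(Ideal.Quotient.mk_eq_mk_iff_sub_mem _ _).mpr (hb j i), Pi.single_apply]
    by_cases h : j = i
    · simp [h]
    · simp [h, Ne.symm h]
  simpa [hbi, LinearMap.sum_apply] using hmem

/-- The norm ideal is the unit ideal. -/
theorem IsInvertibleModule.span_norm_eq_top {G A L : Type} [Group G] [Fintype G]
    [CommRing A] [MulSemiringAction G A] [AddCommGroup L]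
    [Module A L] (hL : IsInvertibleModule A L)
    (r : L × (L →ₗ[A] A) → fixedSubring G A)
    (hr : ∀ p, (r p : A) = ∏ h : G, h • p.2 p.1) :
    Ideal.span (Set.range r) = ⊤ := by
  by_contra hne
  obtain ⟨P, hP, hle⟩ := Ideal.exists_le_maximal _ hne
  have hsc : SMulCommClass G (fixedSubring G A) A := ⟨fun g a x => by
    change g • ((a : A) * x) = (a : A) * g • x
    rw [smul_mul', a.2 g]⟩
  have hinv : Algebra.IsInvariant (fixedSubring G A) A G := ⟨fun b hb => ⟨⟨b, hb⟩, rfl⟩⟩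
  have hint : Algebra.IsIntegral (fixedSubring G A) A := Algebra.IsInvariant.isIntegral _ A G
  obtain ⟨Q, hQ, hQP⟩ := Ideal.exists_ideal_over_maximal_of_isIntegral (S := A) P (by
    rw [(RingHom.injective_iff_ker_eq_bot _).mp
      (show Function.Injective (algebraMap (fixedSubring G A) A) from Subtype.val_injective)]
    exact bot_le)
  obtain ⟨f, x, hfx⟩ := hL.exists_forall_smul_notMem (G := G) Q
  have h1 : r (x, f) ∈ P := hle (Ideal.subset_span ⟨_, rfl⟩)
  rw [← hQP, Ideal.mem_comap] at h1
  have h2 : ∏ h : G, h • f x ∈ Q := by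
    have := hr (x, f)
    rw [← this]; exact h1
  obtain ⟨h, -, hh⟩ := (Ideal.IsPrime.prod_mem_iff (hp := hQ.isPrime)).mp h2
  exact hfx h hh

theorem brauer_map_stmt9
    (kk G A : Type) [Field kk] [Group G] [Fintype G]
    [CommRing A] [Algebra kk A] [Algebra.FiniteType kk A]  -- `S = Spec A` affine over a field
    [MulSemiringAction G A] [SMulCommClass G kk A]
    -- `L`: a `G`-equivariant line bundle on `S`, i.e. an invertible `A`-module ...
    (L : Type) [AddCommGroup L] [Module A L] (hL : IsInvertibleModule A L)
    -- ... with a semilinear action `σ` of `G`: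
    (σ : G → (L ≃+ L))
    (hσone : ∀ x : L, σ 1 x = x)
    (hσmul : ∀ (g h : G) (x : L), σ (g * h) x = σ g (σ h x))
    (hσlin : ∀ (g : G) (a : A) (x : L), σ g (a • x) = (g • a) • σ g x) :
    -- then some positive `d`-th tensor power `L^{⊗d} = ⨂[A]ᵈ L` descends to an
    -- invertible module `M` on `S/G = Spec Aᴳ`:
    ∃ d : ℕ, 0 < d ∧
    ∃ (M : Type) (_ : AddCommGroup M) (_ : Module (fixedSubring G A) M),
      IsInvertibleModule (fixedSubring G A) M ∧
      -- the `G`-equivariant structure on `L^{⊗d}` induced by `σ`: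
      ∃ ψ : G → ((⨂[A] (_ : Fin d), L) ≃+ (⨂[A] (_ : Fin d), L)),
        (∀ (g : G) (v : Fin d → L),
          ψ g (PiTensorProduct.tprod A v) = PiTensorProduct.tprod A fun i => σ g (v i)) ∧
        -- a `G`-equivariant `A`-linear isomorphism `π*M = A ⊗[Aᴳ] M ≅ L^{⊗d}`,
        -- `G` acting on `A ⊗[Aᴳ] M` through the first factor only (trivial action
        -- on `M`):
        ∃ φ : (A ⊗[fixedSubring G A] M) ≃ₗ[A] (⨂[A] (_ : Fin d), L),
          ∀ (g : G) (a : A) (m : M),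
            φ ((g • a) ⊗ₜ[fixedSubring G A] m) = ψ g (φ (a ⊗ₜ[fixedSubring G A] m)) := by
  classical
  obtain ⟨ψ, hψt, hψl⟩ := exists_psi (A := A) σ hσone hσmul hσlin (Fintype.card G)
  let ε : Fin (Fintype.card G) ≃ G := (Fintype.equivFin G).symm
  -- the permutation of indices induced by left multiplication
  let π : G → Equiv.Perm (Fin (Fintype.card G)) := fun g =>
    ε.trans ((Equiv.mulLeft g).trans ε.symm)
  have hπ : ∀ g i, ε (π g i) = g * ε i := fun g i => by simp [π]
  -- conjugates of functionals
  let cj : (L →ₗ[A] A) → G → (L →ₗ[A] A) := fun f h =>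
    { toFun := fun x => h • f (σ h⁻¹ x)
      map_add' := fun x y => by rw [map_add, map_add, smul_add]
      map_smul' := fun a x => by
        rw [hσlin, map_smul, smul_eq_mul, smul_mul', smul_inv_smul]; rfl }
  have hcj : ∀ f h x, cj f h x = h • f (σ h⁻¹ x) := fun f h x => rfl
  let F : (L →ₗ[A] A) → ((⨂[A] (_ : Fin (Fintype.card G)), L) →ₗ[A] A) := fun f =>
    PiTensorProduct.lift ((MultilinearMap.mkPiAlgebra A (Fin (Fintype.card G)) A).compLinearMap
      fun i => cj f (ε i))
  have hF : ∀ f v, F f (PiTensorProduct.tprod A v) = ∏ i, cj f (ε i) (v i) := fun f v => by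
    simp [F]
  let N : L → (⨂[A] (_ : Fin (Fintype.card G)), L) := fun x =>
    PiTensorProduct.tprod A fun i => σ (ε i) x
  have hN : ∀ x g, ψ g (N x) = N x := fun x g => by
    simp only [N]
    rw [hψt, ← hL.tprod_perm (fun i => σ (ε i) x) (π g)]
    simp only [hπ, hσmul]
  have hFN : ∀ f x, F f (N x) = ∏ h : G, h • f x := fun f x => by
    simp only [N]
    rw [hF, ← Equiv.prod_comp ε]
    refine Finset.prod_congr rfl fun i _ => ?_
    rw [hcj, ← hσmul, inv_mul_cancel, hσone]
  have hFinv : ∀ f g x, F f (ψ g x) = g • F f x := fun f g x => by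
    induction x using PiTensorProduct.induction_on with
    | smul_tprod r v =>
      rw [hψl, map_smul, map_smul, smul_eq_mul, smul_eq_mul, smul_mul', hψt, hF,
        ← hL.tprod_perm v (π g), hF, Finset.smul_prod']
      congr 1
      rw [← Equiv.prod_comp (π g)]
      refine Finset.prod_congr rfl fun i _ => ?_
      rw [hcj, hcj, hπ, ← hσmul, mul_inv_rev, inv_mul_cancel_right, mul_smul]
    | add x y hx hy => rw [map_add, map_add, map_add, smul_add, hx, hy]
  have hrank : ∀ f x y, F f x • y = F f y • x := fun f x y => by
    induction x using PiTensorProduct.induction_on with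
    | add x x' hx hx' => rw [map_add, add_smul, smul_add, hx, hx']
    | smul_tprod r v =>
      induction y using PiTensorProduct.induction_on with
      | add y y' hy hy' => rw [map_add, add_smul, smul_add, hy, hy']
      | smul_tprod s w =>
        have : F f (PiTensorProduct.tprod A v) • PiTensorProduct.tprod A w =
            F f (PiTensorProduct.tprod A w) • PiTensorProduct.tprod A v := by
          rw [hF, hF, ← MultilinearMap.map_smul_univ, ← MultilinearMap.map_smul_univ]
          congr 1
          funext i
          exact hL.comm_eval _ _ _
        rw [map_smul, map_smul, smul_assoc, smul_assoc, smul_comm _ s, this, smul_comm _ r,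
          smul_comm _ r]
  let r : L × (L →ₗ[A] A) → fixedSubring G A := fun p =>
    ⟨F p.2 (N p.1), fun g => by rw [← hFinv, hN]⟩
  have htop := hL.span_norm_eq_top r fun p => hFN p.2 p.1
  have h1 : (1 : fixedSubring G A) ∈ Ideal.span (Set.range r) := htop ▸ trivial
  obtain ⟨c, hc⟩ := Finsupp.mem_span_range_iff_exists_finsupp.mp h1
  obtain ⟨M, i1, i2, hM, φ, hφ⟩ := descent_aux (ι := c.support) ψ hψl
    (fun p => (c p.1 : A) • N p.1.1) (fun p => F p.1.2)
    (fun p g => by rw [hψl, hN, (c p.1).2 g]) (fun p g x => hFinv _ _ _)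
    (by
      have := congrArg (fixedSubring G A).subtype hc
      rw [Finsupp.sum, map_sum, map_one, ← Finset.sum_coe_sort] at this
      rw [← this]
      refine Finset.sum_congr rfl fun p _ => ?_
      rw [map_smul]
      rfl)
    (fun p x y => hrank _ _ _)
  exact ⟨Fintype.card G, Fintype.card_pos, M, i1, i2, hM, ψ, hψt, φ, hφ⟩
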